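/- Let g be an odd prime number and let ρ = (w, G) be a geometrically simple weighted permutation representation on X (|X| = 2g). Then ρ is not exceptional. (This is the combinatorial core of Tankeev's theorem that geometrically simple abelian varieties of prime dimension with commutative endomorphism algebra have no exceptional Tate classes.) -/

import Mathlib

open scoped BigOperators

namespace PaperAux

/-- The symbol set `X_{2g}`, modeled as `Fin g ⊕ Fin g`. -/
abbrev X (g : ℕ) := Fin g ⊕ Fin g

/-- The complex conjugation involution `c`, swapping `i` and `ī`. -/
def conjPerm (g : ℕ) : Equiv.Perm (X g) := Equiv.sumComm (Fin g) (Fin g)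

/-- The group `W_{2g}`: the centralizer of `c` in `Sym(X_{2g})`. -/
def Wgrp (g : ℕ) : Subgroup (Equiv.Perm (X g)) := Subgroup.centralizer {conjPerm g}

/-- `w` is a weight function. -/
structure IsWeightFn (g : ℕ) (w : X g → ℚ) : Prop where
  nonneg : ∀ x, 0 ≤ w x
  add_one : ∀ i : Fin g, w (Sum.inl i) + w (Sum.inr i) = 1
  mono : ∀ i j : Fin g, i ≤ j → w (Sum.inl i) ≤ w (Sum.inl j)
  den_dvd : ∀ s : ℚ, s.den ∣ (Finset.univ.filter fun x => w x = s).card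

/-- The map `Φ_ρ : X → MonoidAlgebra ℚ G`,
`Φ_ρ(x) = ∑_{σ ∈ G} w(σ⁻¹ x) • (σ : MonoidAlgebra ℚ G)`. -/
noncomputable def Phi {g : ℕ} (w : X g → ℚ) (G : Subgroup (Equiv.Perm (X g))) (x : X g) :
    MonoidAlgebra ℚ G :=
  ∑ᶠ σ : G, w (((σ : Equiv.Perm (X g))⁻¹) x) • MonoidAlgebra.of ℚ G σ

/-- The sum `∑_{σ ∈ G} σ` in the group algebra. -/
noncomputable def allSum {g : ℕ} (G : Subgroup (Equiv.Perm (X g))) : MonoidAlgebra ℚ G :=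
  ∑ᶠ σ : G, MonoidAlgebra.of ℚ G σ

/-- `ρ = (w, G)` is geometrically simple (with base point `x₀ = Sum.inl 0`):
the stabilizer of `Φ_ρ(x₀)` under left multiplication equals the stabilizer of `x₀`. -/
def GeomSimple {g : ℕ} (w : X g → ℚ) (G : Subgroup (Equiv.Perm (X g))) (x₀ : X g) : Prop :=
  ∀ σ : G, MonoidAlgebra.of ℚ G σ * Phi w G x₀ = Phi w G x₀ ↔ (σ : Equiv.Perm (X g)) x₀ = x₀

/-- The exceptionality identity for a pair of disjoint subsets `T⁺, T⁻ ⊆ Fin g`. -/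
def ExcId {g : ℕ} (w : X g → ℚ) (G : Subgroup (Equiv.Perm (X g)))
    (Tp Tm : Finset (Fin g)) : Prop :=
  (∑ i ∈ Tp, Phi w G (Sum.inl i)) - (∑ j ∈ Tm, Phi w G (Sum.inl j))
    = (((Tp.card : ℚ) - (Tm.card : ℚ)) / 2) • allSum G

/-- `ρ = (w, G)` is exceptional. -/
def IsExceptional {g : ℕ} (w : X g → ℚ) (G : Subgroup (Equiv.Perm (X g))) : Prop :=
  ∃ Tp Tm : Finset (Fin g), Disjoint Tp Tm ∧ (Tp ∪ Tm).Nonempty ∧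
    Even (Tp.card + Tm.card) ∧ ExcId w G Tp Tm

/-- The induced map `σ⁺ : Fin g → Fin g` of `σ ∈ W`. -/
def plusFun {g : ℕ} (σ : Equiv.Perm (X g)) (i : Fin g) : Fin g :=
  Sum.elim id id (σ (Sum.inl i))

/-- The level set equivalence relation on `Fin g`. -/
def levelRel {g : ℕ} (G : Subgroup (Equiv.Perm (X g))) (i j : Fin g) : Prop :=
  ∀ γ ∈ G, (∀ k, plusFun γ k = k) →
    ((γ (Sum.inl i) = Sum.inr i) ↔ (γ (Sum.inl j) = Sum.inr j))

/-- The level set partition, as a setoid. -/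
def levelSetoid {g : ℕ} (G : Subgroup (Equiv.Perm (X g))) : Setoid (Fin g) where
  r := levelRel G
  iseqv := ⟨fun _ _ _ _ => Iff.rfl,
            fun h γ hγ h2 => (h γ hγ h2).symm,
            fun h1 h2 γ hγ h3 => (h1 γ hγ h3).trans (h2 γ hγ h3)⟩

/-- `m`: the number of classes of the level set partition. -/
noncomputable def numLevels {g : ℕ} (G : Subgroup (Equiv.Perm (X g))) : ℕ :=
  Nat.card (Quotient (levelSetoid G))

/-- The angle rank `δ_ρ` of a weighted permutation representation. -/
noncomputable def angleRank {g : ℕ} (w : X g → ℚ) (G : Subgroup (Equiv.Perm (X g))) : ℕ :=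
  Module.finrank ℚ (Submodule.span ℚ (Set.range (Phi w G))) - 1

end PaperAux


/-- Over `ℚ`, if all cyclic cross-correlations of two sequences of prime period vanish, one of
the two sequences is constant. -/
theorem constant_or_constant_of_correlation_eq_zero {p : ℕ} [NeZero p] (hp : p.Prime)
    (a b : Fin p → ℚ) (h : ∀ j, ∑ k, b k * a (k + j) = 0) :
    (∀ i j, a i = a j) ∨ (∀ i j, b i = b j) := by
  have hζ := Complex.isPrimitiveRoot_exp p hp.ne_zero
  set ζ := Complex.exp (2 * Real.pi * Complex.I / p)
  have hadd : ∀ k j : Fin p, ζ ^ (k + j).val = ζ ^ k.val * ζ ^ j.val := by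
    intro k j
    rw [Fin.val_add, ← pow_add, ← pow_eq_pow_mod _ hζ.pow_eq_one]
  have key : (∑ k, (a k : ℂ) * ζ ^ k.val) * (∑ k, (b (-k) : ℂ) * ζ ^ k.val) = 0 := by
    calc _ = (∑ k, (b k : ℂ) * ζ ^ (-k).val) * (∑ l, (a l : ℂ) * ζ ^ l.val) := by
          rw [mul_comm]
          congr 1
          exact Fintype.sum_equiv (Equiv.neg _) _ _ (by simp)
      _ = ∑ k, ∑ j, (b k : ℂ) * a (k + j) * ζ ^ j.val := by
          rw [Finset.sum_mul]
          refine Finset.sum_congr rfl fun k _ => ?_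
          rw [Finset.mul_sum]
          refine (Fintype.sum_equiv (Equiv.addLeft k) _ _ fun j => ?_).symm
          have hj : ζ ^ j.val = ζ ^ (-k).val * ζ ^ (k + j).val := by
            rw [← hadd, neg_add_cancel_left]
          rw [hj, Equiv.coe_addLeft]
          ring
      _ = ∑ j, ((∑ k, b k * a (k + j) : ℚ) : ℂ) * ζ ^ j.val := by
          rw [Finset.sum_comm]
          refine Finset.sum_congr rfl fun j _ => ?_
          push_cast
          rw [Finset.sum_mul]
      _ = 0 := by simp [h]
  rcases mul_eq_zero.mp key with h0 | h0
  · exact .inl ((hζ.sum_eq_zero_iff_forall_eq hp a).mp h0)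
  · refine .inr fun i j => ?_
    simpa using (hζ.sum_eq_zero_iff_forall_eq hp fun k => b (-k)).mp h0 (-i) (-j)

namespace PaperAux

variable {g : ℕ}

theorem apply_conjPerm {σ : Equiv.Perm (X g)} (hσ : σ ∈ Wgrp g) (x : X g) :
    σ (conjPerm g x) = conjPerm g (σ x) :=
  (Equiv.congr_fun (Subgroup.mem_centralizer_iff.mp hσ _ rfl) x).symm

theorem coeff_Phi (w : X g → ℚ) (G : Subgroup (Equiv.Perm (X g))) (x : X g) (σ : G) :
    (Phi w G x).coeff σ = w ((σ : Equiv.Perm (X g))⁻¹ x) := by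
  classical
  have : Fintype G := Fintype.ofFinite G
  rw [Phi, finsum_eq_sum_of_fintype]
  simp [MonoidAlgebra.coeff_sum, Finsupp.single_apply]

theorem coeff_allSum (G : Subgroup (Equiv.Perm (X g))) (σ : G) :
    (allSum G).coeff σ = 1 := by
  classical
  have : Fintype G := Fintype.ofFinite G
  rw [allSum, finsum_eq_sum_of_fintype]
  simp [MonoidAlgebra.coeff_sum, Finsupp.single_apply]

theorem of_mul_Phi (w : X g → ℚ) (G : Subgroup (Equiv.Perm (X g))) (x : X g) (σ : G) :
    MonoidAlgebra.of ℚ G σ * Phi w G x = Phi w G ((σ : Equiv.Perm (X g)) x) := by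
  apply MonoidAlgebra.coeff_injective
  ext τ
  rw [MonoidAlgebra.of_apply, MonoidAlgebra.coeff_single_mul_apply, coeff_Phi, coeff_Phi]
  simp

/-- In a geometrically simple representation, two distinct symbols are separated by the weights
of their translates. -/
theorem eq_of_forall_weight_eq {w : X g → ℚ} {G : Subgroup (Equiv.Perm (X g))} {x₀ : X g}
    (htrans : ∀ x y : X g, ∃ σ ∈ G, σ x = y) (hsimple : GeomSimple w G x₀) {x y : X g}
    (h : ∀ τ ∈ G, w (τ x) = w (τ y)) : x = y := by
  obtain ⟨ρ, hρ, rfl⟩ := htrans x₀ x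
  obtain ⟨π, hπ, rfl⟩ := htrans x₀ y
  have hfix := (hsimple ⟨ρ⁻¹ * π, G.mul_mem (G.inv_mem hρ) hπ⟩).mp (by
    rw [of_mul_Phi]
    apply MonoidAlgebra.coeff_injective
    ext τ
    rw [coeff_Phi, coeff_Phi]
    simpa using (h _ (G.mul_mem (G.inv_mem τ.2) (G.inv_mem hρ))).symm)
  exact (Equiv.Perm.inv_eq_iff_eq.mp hfix).symm

theorem sum_weight_of_ExcId {w : X g → ℚ} {G : Subgroup (Equiv.Perm (X g))}
    {Tp Tm : Finset (Fin g)} (h : ExcId w G Tp Tm) {τ : Equiv.Perm (X g)} (hτ : τ ∈ G) :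
    ∑ i ∈ Tp, (w (τ (Sum.inl i)) - 1 / 2) - ∑ i ∈ Tm, (w (τ (Sum.inl i)) - 1 / 2) = 0 := by
  have h1 := congrArg (fun z => z.coeff (⟨τ, hτ⟩ : G)⁻¹) h
  simp only [MonoidAlgebra.coeff_sub, MonoidAlgebra.coeff_sum, Finsupp.sub_apply,
    Finsupp.finsetSum_apply, coeff_Phi, MonoidAlgebra.coeff_smul_apply, coeff_allSum,
    Subgroup.coe_inv, inv_inv, smul_eq_mul, mul_one] at h1
  simp only [Finset.sum_sub_distrib, Finset.sum_const, nsmul_eq_mul]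
  linarith

/-- The function on symbols that is odd under conjugation and equals `1` on `Tp`, `-1` on `Tm`
and `0` on the other unbarred symbols. -/
def signFun (Tp Tm : Finset (Fin g)) : X g → ℚ :=
  Sum.elim (fun i => (if i ∈ Tp then 1 else 0) - (if i ∈ Tm then 1 else 0))
    (fun i => (if i ∈ Tm then 1 else 0) - (if i ∈ Tp then 1 else 0))

theorem signFun_conjPerm (Tp Tm : Finset (Fin g)) (x : X g) :
    signFun Tp Tm (conjPerm g x) = -signFun Tp Tm x := by
  rcases x with i | i <;> simp [signFun, conjPerm]

theorem signFun_inl_eq_zero {Tp Tm : Finset (Fin g)} (h : Disjoint Tp Tm) (i : Fin g) :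
    signFun Tp Tm (Sum.inl i) = 0 ↔ i ∉ Tp ∪ Tm := by
  have : i ∈ Tp → i ∉ Tm := fun hi => Finset.disjoint_left.mp h hi
  by_cases h1 : i ∈ Tp <;> by_cases h2 : i ∈ Tm <;> simp_all [signFun]

theorem sum_signFun_mul (Tp Tm : Finset (Fin g)) (F : X g → ℚ) :
    ∑ i, signFun Tp Tm (Sum.inl i) * F (Sum.inl i)
      = ∑ i ∈ Tp, F (Sum.inl i) - ∑ i ∈ Tm, F (Sum.inl i) := by
  simp [signFun, sub_mul, Finset.sum_sub_distrib]

theorem IsWeightFn.sub_half_conjPerm {w : X g → ℚ} (hw : IsWeightFn g w) (x : X g) :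
    w (conjPerm g x) - 1 / 2 = -(w x - 1 / 2) := by
  rcases x with i | i <;> have := hw.add_one i <;> simp [conjPerm] <;> linarith

/-- The index underlying a symbol, forgetting the bar. -/
def pairIndex : X g → Fin g := Sum.elim id id

theorem pairIndex_eq_iff {x y : X g} :
    pairIndex x = pairIndex y ↔ x = y ∨ x = conjPerm g y := by
  rcases x with i | i <;> rcases y with j | j <;> simp [pairIndex, conjPerm]

theorem apply_inl_pairIndex {α : Type*} {h : X g → α} (hh : ∀ x, h (conjPerm g x) = h x)
    (x : X g) : h (Sum.inl (pairIndex x)) = h x := by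
  rcases x with i | i
  · rfl
  · exact (hh (Sum.inl i)).symm

/-- A transitive permutation group on the symbols has an element of order `g` if `g` is prime. -/
theorem exists_orderOf_eq (hgp : g.Prime) (G : Subgroup (Equiv.Perm (X g)))
    (htrans : ∀ x y : X g, ∃ σ ∈ G, σ x = y) : ∃ σ ∈ G, orderOf σ = g := by
  have : Fact g.Prime := ⟨hgp⟩
  have : MulAction.IsPretransitive G (X g) :=
    ⟨fun x y => (htrans x y).elim fun σ hσ => ⟨⟨σ, hσ.1⟩, hσ.2⟩⟩
  have hdvd : g ∣ Nat.card G := by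
    have h := (MulAction.stabilizer G (Sum.inl ⟨0, hgp.pos⟩ : X g)).index_dvd_card
    rw [MulAction.index_stabilizer_of_transitive] at h
    exact (Dvd.intro_left 2 (by simp [two_mul])).trans h
  obtain ⟨σ, hσ⟩ := exists_prime_orderOf_dvd_card' g hdvd
  exact ⟨σ, σ.2, by rw [Subgroup.orderOf_coe, hσ]⟩

/-- An element of odd prime order `g` commuting with conjugation permutes the conjugate pairs
cyclically, as soon as it moves the chosen symbol. -/
theorem bijective_pairIndex_pow (hgp : g.Prime) (hodd : Odd g) {σ : Equiv.Perm (X g)}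
    (hσW : σ ∈ Wgrp g) (hσ : orderOf σ = g) {x : X g} (hx : σ x ≠ x) :
    Function.Bijective fun k : Fin g => pairIndex ((σ ^ k.val) x) := by
  have hlt : ∀ k l : Fin g, k < l →
      pairIndex ((σ ^ k.val) x) ≠ pairIndex ((σ ^ l.val) x) := by
    intro k l hkl he
    obtain ⟨m, hm⟩ := Nat.exists_eq_add_of_lt hkl
    have hsplit : (σ ^ l.val) x = (σ ^ k.val) ((σ ^ (m + 1)) x) := by
      rw [← Equiv.Perm.mul_apply, ← pow_add, hm, add_assoc]
    have hcase : (σ ^ (m + 1)) x = x ∨ (σ ^ (m + 1)) x = conjPerm g x := by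
      rcases pairIndex_eq_iff.mp he.symm with h | h
      · exact .inl ((σ ^ k.val).injective (hsplit.symm.trans h))
      · refine .inr ((σ ^ k.val).injective (hsplit.symm.trans (h.trans ?_)))
        exact (apply_conjPerm ((Wgrp g).pow_mem hσW _) x).symm
    have hfix : (σ ^ (2 * (m + 1))) x = x := by
      rw [two_mul, pow_add, Equiv.Perm.mul_apply]
      rcases hcase with h | h
      · rw [h, h]
      · rw [h, apply_conjPerm ((Wgrp g).pow_mem hσW _), h]
        rcases x with i | i <;> rfl
    have hcop : Nat.Coprime (2 * (m + 1)) g := by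
      refine Nat.Coprime.mul_left (Nat.coprime_two_left.mpr hodd) ?_
      refine (Nat.coprime_of_lt_prime (Nat.succ_ne_zero m) ?_ hgp).symm
      have := l.isLt
      omega
    apply hx
    have h1 : σ ∈ Subgroup.zpowers (σ ^ (2 * (m + 1))) := by
      obtain ⟨n, hn⟩ := exists_pow_eq_self_of_coprime (hσ.symm ▸ hcop)
      exact ⟨n, (zpow_natCast _ n).trans hn⟩
    obtain ⟨n, hn⟩ := h1
    rw [← hn]
    exact Equiv.Perm.zpow_apply_eq_self_of_apply_eq_self hfix n
  refine (Fintype.bijective_iff_injective_and_card _).mpr ⟨fun k l he => ?_, rfl⟩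
  rcases lt_trichotomy k l with h | h | h
  · exact (hlt k l h he).elim
  · exact h
  · exact (hlt l k h he.symm).elim

end PaperAux

open PaperAux

/-- a geometrically simple wpr in odd prime dimension `g` is not exceptional. -/
theorem not_exceptional_of_odd_prime {g : ℕ} (hgp : Nat.Prime g) (hodd : Odd g)
    (w : X g → ℚ) (hw : IsWeightFn g w)
    (G : Subgroup (Equiv.Perm (X g))) (hGW : G ≤ Wgrp g) (hc : conjPerm g ∈ G)
    (htrans : ∀ x y : X g, ∃ σ ∈ G, σ x = y)
    (hsimple : GeomSimple w G (Sum.inl ⟨0, hgp.pos⟩)) :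
    ¬ IsExceptional w G := by
  rintro ⟨Tp, Tm, hdisj, ⟨i₀, hi₀⟩, heven, hexc⟩
  have : NeZero g := ⟨hgp.ne_zero⟩
  obtain ⟨σ, hσG, hσ⟩ := exists_orderOf_eq hgp G htrans
  have hσg : σ ^ g = 1 := orderOf_dvd_iff_pow_eq_one.mp hσ.dvd
  obtain ⟨x, hx⟩ : ∃ x, σ x ≠ x := by
    by_contra! h
    rw [show σ = 1 from Equiv.ext h, orderOf_one] at hσ
    exact hgp.one_lt.ne hσ
  have hbij := bijective_pairIndex_pow hgp hodd (hGW hσG) hσ hx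
  have hpow : ∀ k j : Fin g, (σ ^ (k + j).val) x = (σ ^ j.val) ((σ ^ k.val) x) := by
    intro k j
    rw [← Equiv.Perm.mul_apply, ← pow_add, Fin.val_add, add_comm j.val,
      ← pow_eq_pow_mod _ hσg]
  have hcorr : ∀ τ ∈ G, ∀ j : Fin g, ∑ k : Fin g, signFun Tp Tm ((σ ^ k.val) x) *
      (w (τ ((σ ^ (k + j).val) x)) - 1 / 2) = 0 := by
    intro τ hτ j
    have hπ : τ * σ ^ j.val ∈ G := G.mul_mem hτ (G.pow_mem hσG _)
    set h : X g → ℚ := fun y => signFun Tp Tm y * (w ((τ * σ ^ j.val) y) - 1 / 2) with hh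
    have hinv : ∀ y, h (conjPerm g y) = h y := by
      intro y
      simp only [hh]
      rw [signFun_conjPerm, apply_conjPerm (hGW hπ), hw.sub_half_conjPerm, neg_mul_neg]
    calc _ = ∑ k : Fin g, h (Sum.inl (pairIndex ((σ ^ k.val) x))) := by
          refine Finset.sum_congr rfl fun k _ => ?_
          rw [apply_inl_pairIndex hinv, hpow]
          rfl
      _ = ∑ i, h (Sum.inl i) := hbij.sum_comp fun i => h (Sum.inl i)
      _ = 0 := by
          rw [hh, sum_signFun_mul Tp Tm fun y => w ((τ * σ ^ j.val) y) - 1 / 2]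
          exact sum_weight_of_ExcId hexc hπ
  by_cases hb : ∀ i j : Fin g, signFun Tp Tm ((σ ^ i.val) x) = signFun Tp Tm ((σ ^ j.val) x)
  · have hzero : ∀ y, signFun Tp Tm (Sum.inl (pairIndex y)) = 0 ↔ signFun Tp Tm y = 0 :=
      fun y => (apply_inl_pairIndex (h := fun y => signFun Tp Tm y = 0)
        (fun z => by rw [signFun_conjPerm, neg_eq_zero]) y).to_iff
    have huniv : Tp ∪ Tm = Finset.univ := by
      refine Finset.eq_univ_of_forall fun i => ?_
      by_contra hi
      obtain ⟨k, rfl⟩ := hbij.surjective i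
      obtain ⟨l, rfl⟩ := hbij.surjective i₀
      rw [← signFun_inl_eq_zero hdisj, hzero, hb k l, ← hzero, signFun_inl_eq_zero hdisj] at hi
      exact hi hi₀
    rw [← Finset.card_union_of_disjoint hdisj, huniv, Finset.card_univ, Fintype.card_fin] at heven
    exact Nat.not_even_iff_odd.mpr hodd heven
  · refine hx (eq_of_forall_weight_eq htrans hsimple fun τ hτ => ?_)
    have hconst := (constant_or_constant_of_correlation_eq_zero hgp
      (fun k => w (τ ((σ ^ k.val) x)) - 1 / 2) _ (hcorr τ hτ)).resolve_right hb
    have h01 := hconst ⟨1, hgp.one_lt⟩ ⟨0, hgp.pos⟩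
    simpa using h01
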